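/- Let G be a weakly observable directed graph on N vertices such that at most C (with C ≥ 1) of its vertices are not strongly observable. Then there exists T₀ (depending on G) such that for every horizon T ≥ T₀ there is a policy whose regret satisfies R_a(T) ≤ 9·(4C)^{1/3}·T^{2/3} for every loss sequence ℓ^(1),…,ℓ^(T) : V → [0,1] and every arm a ∈ V. -/

import Mathlib

open scoped BigOperators

/-- A policy maps the chronological history of (arm, feedback) pairs to a
probability distribution over arms.  The feedback after playing arm `a` is
recorded as a function `V → Option ℝ`, giving the observed loss on the
out-neighbors of `a` and `none` elsewhere. -/
def Policy (V : Type) : Type :=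
  List (V × (V → Option ℝ)) → PMF V

/-- The feedback revealed when arm `a` is played against the loss vector `ℓ`:
exactly the values `ℓ j` for out-neighbors `j` of `a`. -/
def feedbackOf {V : Type} (E : V → V → Bool) (ℓ : V → ℝ) (a : V) : V → Option ℝ :=
  fun j => if E a j then some (ℓ j) else none

/-- The chronological history produced by playing the arm sequence `as`
against the loss sequence `ℓ`. -/
def hist {V : Type} (E : V → V → Bool) (ℓ : ℕ → V → ℝ) (as : List V) :
    List (V × (V → Option ℝ)) :=
  (List.range as.length).zipWith (fun t a => (a, feedbackOf E (ℓ t) a)) as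

/-- Probability that the policy `π` plays exactly the arm sequence `as`
during the first `T` rounds. -/
noncomputable def seqProb {V : Type} [Fintype V] (π : Policy V) (E : V → V → Bool)
    (ℓ : ℕ → V → ℝ) (T : ℕ) (as : Fin T → V) : ℝ :=
  ∏ t : Fin T, (π (hist E ℓ ((List.ofFn as).take t.val)) (as t)).toReal

/-- Expected cumulative loss of the policy `π` over `T` rounds. -/
noncomputable def expectedLoss {V : Type} [Fintype V] (π : Policy V) (E : V → V → Bool)
    (ℓ : ℕ → V → ℝ) (T : ℕ) : ℝ :=
  ∑ as : Fin T → V, seqProb π E ℓ T as * ∑ t : Fin T, ℓ t.val (as t)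

/-- Regret of the policy `π` with respect to the fixed arm `a`. -/
noncomputable def regretTo {V : Type} [Fintype V] (π : Policy V) (E : V → V → Bool)
    (ℓ : ℕ → V → ℝ) (T : ℕ) (a : V) : ℝ :=
  expectedLoss π E ℓ T - ∑ t : Fin T, ℓ t.val a

/-- Regret of the policy `π` with respect to the best fixed arm. -/
noncomputable def regret {V : Type} [Fintype V] (π : Policy V) (E : V → V → Bool)
    (ℓ : ℕ → V → ℝ) (T : ℕ) : ℝ :=
  expectedLoss π E ℓ T - ⨅ a : V, ∑ t : Fin T, ℓ t.val a

/-- A loss sequence taking values in `[0,1]`. -/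
def ValidLoss {V : Type} (ℓ : ℕ → V → ℝ) : Prop :=
  ∀ t v, 0 ≤ ℓ t v ∧ ℓ t v ≤ 1

/-- The mini-max regret of the feedback graph `E` on `V` at horizon `T`. -/
noncomputable def minimaxRegret (V : Type) [Fintype V] (E : V → V → Bool) (T : ℕ) : ℝ :=
  ⨅ π : Policy V, ⨆ ℓ : {ℓ : ℕ → V → ℝ // ValidLoss ℓ}, regret π E ℓ.1 T

/-- A vertex is observable if it has an in-neighbor. -/
def ObservableVertex {V : Type} (E : V → V → Bool) (v : V) : Prop :=
  ∃ u, E u v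

/-- A vertex is strongly observable if it has a self-loop or is observed by
all other vertices. -/
def StronglyObservableVertex {V : Type} (E : V → V → Bool) (v : V) : Prop :=
  E v v ∨ ∀ u, u ≠ v → E u v

/-- A graph is observable if every vertex is observable. -/
def Observable {V : Type} (E : V → V → Bool) : Prop :=
  ∀ v, ObservableVertex E v

/-- A graph is strongly observable if every vertex is strongly observable. -/
def StronglyObservable {V : Type} (E : V → V → Bool) : Prop :=
  ∀ v, StronglyObservableVertex E v

/-- A graph is weakly observable if it is observable but not strongly
observable. -/
def WeaklyObservable {V : Type} (E : V → V → Bool) : Prop :=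
  Observable E ∧ ¬ StronglyObservable E

/-- The objective minimised by follow-the-regularised-leader with the `1/2`-Tsallis entropy
and coordinate-dependent learning rates `η`. -/
noncomputable def tsallisObjective {V : Type} [Fintype V] (η L z : V → ℝ) : ℝ :=
  ∑ i, (L i * z i - 2 * √(z i) / η i)

/-- Probability vectors all of whose entries are at least `ε`. -/
def clippedSimplex (V : Type) [Fintype V] (ε : ℝ) : Set (V → ℝ) :=
  {x | (∀ i, ε ≤ x i) ∧ ∑ i, x i = 1}

/-- The probability that the loss of `i` is revealed when the arm is drawn from `p`. -/
def obsProb {V : Type} [Fintype V] (E : V → V → Bool) (p : V → ℝ) (i : V) : ℝ :=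
  ∑ a, if E a i then p a else 0

/-- The importance-weighted loss estimate after drawing arm `a` from `p`. -/
noncomputable def lossEstimate {V : Type} [Fintype V] (E : V → V → Bool) (p ℓ : V → ℝ) (a i : V) :
    ℝ :=
  if E a i then ℓ i / obsProb E p i else 0

/-- The mixture of `x` with an exploration distribution that plays the observer `d u` of
`u ∈ W` with probability proportional to `√(x u)`. -/
noncomputable def exploreMix {V : Type} [Fintype V] [DecidableEq V] (W : Finset V) (d : V → V)
    (γ : ℝ) (x : V → ℝ) (a : V) : ℝ :=
  (1 - γ) * x a + γ * ((∑ u ∈ W with d u = a, √(x u)) / ∑ u ∈ W, √(x u))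

theorem linear_le_tsallis_divergence_add {x y η a : ℝ} (hx : 0 < x) (hy : 0 ≤ y) (hη : 0 < η)
    (ha : -(1 / 2) ≤ a * η * √x) :
    a * (x - y) ≤ (√y - √x) ^ 2 / (η * √x) + 2 * η * (x * √x) * a ^ 2 := by
  obtain ⟨r, hr, rfl⟩ : ∃ r, 0 < r ∧ r ^ 2 = x := ⟨√x, Real.sqrt_pos.2 hx, Real.sq_sqrt hx.le⟩
  obtain ⟨s, hs, rfl⟩ : ∃ s, 0 ≤ s ∧ s ^ 2 = y := ⟨√y, Real.sqrt_nonneg _, Real.sq_sqrt hy⟩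
  rw [Real.sqrt_sq hr.le] at *
  rw [Real.sqrt_sq hs]
  have hηr : 0 < η * r := mul_pos hη hr
  rw [← sub_nonneg]
  have key : (s - r) ^ 2 / (η * r) + 2 * η * (r ^ 2 * r) * a ^ 2 - a * (r ^ 2 - s ^ 2)
      = ((s - r) ^ 2 * (1 / 2 + a * η * r) + (1 / 2) * (s - r + 2 * r * (a * η * r)) ^ 2)
        / (η * r) := by
    field_simp
    ring
  rw [key]
  have : 0 ≤ 1 / 2 + a * η * r := by linarith
  positivity

theorem tsallisObjective_divergence_le {V : Type} [Fintype V] {η L x y : V → ℝ} {ε : ℝ}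
    (hε : 0 < ε) (hη : ∀ i, 0 < η i) (hx : x ∈ clippedSimplex V ε) (hy : y ∈ clippedSimplex V ε)
    (hmin : ∀ z ∈ clippedSimplex V ε, tsallisObjective η L x ≤ tsallisObjective η L z) :
    tsallisObjective η L x + ∑ i, (√(y i) - √(x i)) ^ 2 / (η i * √(x i))
      ≤ tsallisObjective η L y := by
  have hxp : ∀ i, 0 < x i := fun i => hε.trans_le (hx.1 i)
  have hyp : ∀ i, 0 < y i := fun i => hε.trans_le (hy.1 i)
  have hfin : ∀ s ∈ Set.Ioc (0 : ℝ) 1,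
      0 ≤ ∑ i, (y i - x i) * (L i - 2 / η i / (√(x i + s * (y i - x i)) + √(x i))) := by
    intro s hs
    have hz : ∀ i, ε ≤ x i + s * (y i - x i) := fun i => by
      nlinarith [hx.1 i, hy.1 i, hs.1, hs.2]
    have hmem : (fun i => x i + s * (y i - x i)) ∈ clippedSimplex V ε := by
      refine ⟨hz, ?_⟩
      rw [Finset.sum_add_distrib, ← Finset.mul_sum, Finset.sum_sub_distrib, hx.2, hy.2]
      ring
    have h := hmin _ hmem
    rw [tsallisObjective, tsallisObjective, ← sub_nonneg, ← Finset.sum_sub_distrib] at h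
    have heq : ∑ i, (L i * (x i + s * (y i - x i)) - 2 * √(x i + s * (y i - x i)) / η i
          - (L i * x i - 2 * √(x i) / η i))
        = s * ∑ i, (y i - x i) * (L i - 2 / η i / (√(x i + s * (y i - x i)) + √(x i))) := by
      rw [Finset.mul_sum]
      refine Finset.sum_congr rfl fun i _ => ?_
      have hzi := hε.trans_le (hz i)
      have h1 := Real.sqrt_pos.2 hzi
      have h2 := Real.sqrt_pos.2 (hxp i)
      have h3 := Real.sq_sqrt hzi.le
      have h4 := Real.sq_sqrt (hxp i).le
      have h5 := hη i
      have h6 : √(x i + s * (y i - x i)) - √(x i)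
          = s * (y i - x i) / (√(x i + s * (y i - x i)) + √(x i)) := by
        rw [eq_div_iff (by positivity)]
        nlinarith
      calc _ = s * L i * (y i - x i)
            - 2 / η i * (√(x i + s * (y i - x i)) - √(x i)) := by ring
        _ = _ := by rw [h6]; ring
    rw [heq] at h
    exact nonneg_of_mul_nonneg_right h hs.1
  have hlim : 0 ≤ ∑ i, (y i - x i) * (L i - 2 / η i / (√(x i) + √(x i))) := by
    have ht : Filter.Tendsto
        (fun s : ℝ => ∑ i, (y i - x i) * (L i - 2 / η i / (√(x i + s * (y i - x i)) + √(x i))))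
        (nhdsWithin 0 (Set.Ioi 0))
        (nhds (∑ i, (y i - x i) * (L i - 2 / η i / (√(x i) + √(x i))))) := by
      refine tendsto_nhdsWithin_of_tendsto_nhds ?_
      have hc : ContinuousAt (fun s : ℝ =>
          ∑ i, (y i - x i) * (L i - 2 / η i / (√(x i + s * (y i - x i)) + √(x i)))) 0 := by
        refine tendsto_finsetSum _ fun i _ => ?_
        have hne : √(x i + 0 * (y i - x i)) + √(x i) ≠ 0 := by
          have := Real.sqrt_pos.2 (hxp i)
          positivity
        exact ContinuousAt.mul continuousAt_const
          (continuousAt_const.sub (ContinuousAt.div continuousAt_const (by fun_prop) hne))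
      simpa [ContinuousAt] using hc
    refine ge_of_tendsto ht ?_
    filter_upwards [Ioc_mem_nhdsGT (zero_lt_one' ℝ)] with s hs using hfin s hs
  have hsum : tsallisObjective η L y - tsallisObjective η L x
      - ∑ i, (√(y i) - √(x i)) ^ 2 / (η i * √(x i))
      = ∑ i, (y i - x i) * (L i - 2 / η i / (√(x i) + √(x i))) := by
    rw [tsallisObjective, tsallisObjective, ← Finset.sum_sub_distrib, ← Finset.sum_sub_distrib]
    refine Finset.sum_congr rfl fun i _ => ?_
    have h2 := Real.sqrt_pos.2 (hxp i)
    have h3 := Real.sq_sqrt (hxp i).le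
    have h4 := Real.sq_sqrt (hyp i).le
    have h5 := hη i
    have h6 : y i - x i = (√(y i) - √(x i)) ^ 2 + 2 * √(x i) * (√(y i) - √(x i)) := by
      nlinarith
    have h7 : 2 / η i / (√(x i) + √(x i)) = 1 / (η i * √(x i)) := by
      field_simp
      ring
    rw [h7, mul_sub, mul_one_div, h6, add_div]
    have h8 : 2 * √(x i) * (√(y i) - √(x i)) / (η i * √(x i))
        = 2 * (√(y i) - √(x i)) / η i := by
      field_simp
    rw [h8]
    linear_combination L i * h6
  linarith

/-- One step of follow-the-regularised-leader; the loss vector may be shifted by any constant. -/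
theorem tsallisObjective_step {V : Type} [Fintype V] {η L M x y : V → ℝ} {ε : ℝ} (c : ℝ)
    (hε : 0 < ε) (hη : ∀ i, 0 < η i) (hx : x ∈ clippedSimplex V ε) (hy : y ∈ clippedSimplex V ε)
    (hmin : ∀ z ∈ clippedSimplex V ε, tsallisObjective η L x ≤ tsallisObjective η L z)
    (hc : ∀ i, -(1 / 2) ≤ (M i - c) * η i * √(x i)) :
    tsallisObjective η L x + ∑ i, x i * M i
      ≤ tsallisObjective η (L + M) y + ∑ i, 2 * η i * (x i * √(x i)) * (M i - c) ^ 2 := by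
  have h1 := tsallisObjective_divergence_le hε hη hx hy hmin
  have h2 : tsallisObjective η (L + M) y = tsallisObjective η L y + ∑ i, y i * M i := by
    rw [tsallisObjective, tsallisObjective, ← Finset.sum_add_distrib]
    refine Finset.sum_congr rfl fun i _ => ?_
    rw [Pi.add_apply]
    ring
  have h3 : ∑ i, (M i - c) * (x i - y i) ≤ ∑ i, ((√(y i) - √(x i)) ^ 2 / (η i * √(x i))
      + 2 * η i * (x i * √(x i)) * (M i - c) ^ 2) :=
    Finset.sum_le_sum fun i _ => linear_le_tsallis_divergence_add (hε.trans_le (hx.1 i))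
      (hε.le.trans (hy.1 i)) (hη i) (hc i)
  have h4 : ∑ i, (M i - c) * (x i - y i) = ∑ i, x i * M i - ∑ i, y i * M i := by
    have : ∑ i, c * (x i - y i) = 0 := by
      rw [← Finset.mul_sum, Finset.sum_sub_distrib, hx.2, hy.2]
      ring
    rw [← Finset.sum_sub_distrib, ← sub_zero (∑ i, (x i * M i - y i * M i)), ← this,
      ← Finset.sum_sub_distrib]
    exact Finset.sum_congr rfl fun i _ => by ring
  rw [Finset.sum_add_distrib] at h3
  linarith

theorem exists_tsallisObjective_minimizer {V : Type} [Fintype V] (η L : V → ℝ) {ε : ℝ}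
    (hne : (clippedSimplex V ε).Nonempty) (hε : 0 ≤ ε) :
    ∃ x ∈ clippedSimplex V ε,
      ∀ z ∈ clippedSimplex V ε, tsallisObjective η L x ≤ tsallisObjective η L z := by
  have hcl : IsClosed (clippedSimplex V ε) := by
    rw [clippedSimplex, Set.ofPred_and, Set.ofPred_forall]
    exact (isClosed_iInter fun i => isClosed_le continuous_const (continuous_apply i)).inter
      (isClosed_eq (by fun_prop) continuous_const)
  have hcomp : IsCompact (clippedSimplex V ε) := by
    refine (isCompact_univ_pi fun _ : V => isCompact_Icc (a := (0 : ℝ)) (b := 1)).of_isClosed_subset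
      hcl fun x hx i _ => ⟨hε.trans (hx.1 i), ?_⟩
    rw [← hx.2]
    exact Finset.single_le_sum (fun j _ => hε.trans (hx.1 j)) (Finset.mem_univ i)
  have hcont : Continuous (tsallisObjective η L) := by
    unfold tsallisObjective
    fun_prop
  exact hcomp.exists_isMinOn hne hcont.continuousOn

theorem sum_prod_take_snoc {V : Type} [Fintype V] (p : List V → V → ℝ) (T : ℕ)
    (f : (Fin (T + 1) → V) → ℝ) :
    ∑ as : Fin (T + 1) → V, (∏ t : Fin (T + 1), p ((List.ofFn as).take t) (as t)) * f as
      = ∑ as : Fin T → V, (∏ t : Fin T, p ((List.ofFn as).take t) (as t))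
        * ∑ a, p (List.ofFn as) a * f (Fin.snoc (α := fun _ => V) as a) := by
  rw [← (Fin.snocEquiv fun _ : Fin (T + 1) => V).sum_comp, Fintype.sum_prod_type_right]
  refine Finset.sum_congr rfl fun as _ => ?_
  rw [Finset.mul_sum]
  refine Finset.sum_congr rfl fun a _ => ?_
  change (∏ t : Fin (T + 1), p ((List.ofFn (Fin.snoc as a : Fin (T + 1) → V)).take t)
    ((Fin.snoc as a : Fin (T + 1) → V) t)) * f (Fin.snoc (α := fun _ => V) as a) = _
  rw [Fin.prod_univ_castSucc, List.ofFn_succ', ← mul_assoc]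
  simp only [Fin.snoc_castSucc, Fin.snoc_last, Fin.val_castSucc, Fin.val_last,
    List.concat_eq_append]
  congr 2
  · refine Finset.prod_congr rfl fun t _ => ?_
    rw [List.take_append_of_le_length (by simp [t.2.le])]
  · rw [List.take_append_of_le_length (by simp), List.take_of_length_le (by simp)]

theorem sum_prod_take_eq_one {V : Type} [Fintype V] {p : List V → V → ℝ}
    (hp1 : ∀ l, ∑ a, p l a = 1) (T : ℕ) :
    ∑ as : Fin T → V, ∏ t : Fin T, p ((List.ofFn as).take t) (as t) = 1 := by
  induction T with
  | zero => simp
  | succ T ih => simpa [hp1, ih] using sum_prod_take_snoc p T fun _ => 1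

/-- Summing a per-round drift inequality over the law of the arm sequence. -/
theorem sum_prod_take_mul_le {V : Type} [Fintype V] {p : List V → V → ℝ}
    (hp0 : ∀ l a, 0 ≤ p l a) (hp1 : ∀ l, ∑ a, p l a = 1) (r : ℕ → V → ℝ) (Ψ : List V → ℝ) (k : ℝ)
    (hstep : ∀ l : List V, ∑ a, p l a * (r l.length a + Ψ (l ++ [a])) ≤ Ψ l + k) (T : ℕ) :
    ∑ as : Fin T → V, (∏ t : Fin T, p ((List.ofFn as).take t) (as t))
      * (∑ t : Fin T, r t (as t) + Ψ (List.ofFn as)) ≤ Ψ [] + T * k := by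
  induction T with
  | zero => simp
  | succ T ih =>
    rw [sum_prod_take_snoc p T fun as => ∑ t : Fin (T + 1), r t (as t) + Ψ (List.ofFn as)]
    calc _ ≤ ∑ as : Fin T → V, ((∏ t : Fin T, p ((List.ofFn as).take t) (as t))
          * (∑ t : Fin T, r t (as t) + Ψ (List.ofFn as))
            + (∏ t : Fin T, p ((List.ofFn as).take t) (as t)) * k) := by
          refine Finset.sum_le_sum fun as _ => ?_
          have h := hstep (List.ofFn as)
          rw [List.length_ofFn] at h
          rw [← mul_add]
          refine mul_le_mul_of_nonneg_left ?_ (Finset.prod_nonneg fun t _ => hp0 _ _)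
          have hsum : ∑ t : Fin T, r t (as t)
              = ∑ a, p (List.ofFn as) a * ∑ t : Fin T, r t (as t) := by
            rw [← Finset.sum_mul, hp1, one_mul]
          calc _ = ∑ t : Fin T, r t (as t)
                + ∑ a, p (List.ofFn as) a * (r T a + Ψ (List.ofFn as ++ [a])) := by
                rw [hsum, ← Finset.sum_add_distrib]
                refine Finset.sum_congr rfl fun a _ => ?_
                rw [Fin.sum_univ_castSucc, List.ofFn_succ']
                simp only [Fin.snoc_castSucc, Fin.snoc_last, Fin.val_castSucc, Fin.val_last,
                  List.concat_eq_append]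
                ring
            _ ≤ _ := by linarith
      _ ≤ _ := by
          rw [Finset.sum_add_distrib, ← Finset.sum_mul, sum_prod_take_eq_one hp1]
          push_cast
          linarith

theorem exploreMix_sum {V : Type} [Fintype V] [DecidableEq V] {W : Finset V} (d : V → V)
    (γ : ℝ) {x : V → ℝ} (hx : ∑ i, x i = 1) (hS : 0 < ∑ u ∈ W, √(x u)) :
    ∑ a, exploreMix W d γ x a = 1 := by
  simp only [exploreMix]
  rw [Finset.sum_add_distrib, ← Finset.mul_sum, ← Finset.mul_sum, ← Finset.sum_div, hx,
    Finset.sum_fiberwise, div_self hS.ne']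
  ring

theorem mul_le_exploreMix {V : Type} [Fintype V] [DecidableEq V] (W : Finset V) (d : V → V)
    {γ : ℝ} (x : V → ℝ) (hγ : 0 ≤ γ) (a : V) : (1 - γ) * x a ≤ exploreMix W d γ x a := by
  have h1 : 0 ≤ ∑ u ∈ W with d u = a, √(x u) := Finset.sum_nonneg fun _ _ => Real.sqrt_nonneg _
  have h2 : 0 ≤ ∑ u ∈ W, √(x u) := Finset.sum_nonneg fun _ _ => Real.sqrt_nonneg _
  exact le_add_of_nonneg_right (by positivity)

theorem mul_sqrt_div_le_exploreMix {V : Type} [Fintype V] [DecidableEq V] {W : Finset V}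
    (d : V → V) {γ : ℝ} {x : V → ℝ} (hγ : 0 ≤ γ) (hγ1 : γ ≤ 1) (hx : ∀ i, 0 ≤ x i) {u : V}
    (hu : u ∈ W) : γ * (√(x u) / ∑ w ∈ W, √(x w)) ≤ exploreMix W d γ x (d u) := by
  have h1 : √(x u) ≤ ∑ w ∈ W with d w = d u, √(x w) :=
    Finset.single_le_sum (f := fun w => √(x w)) (fun _ _ => Real.sqrt_nonneg _)
      (Finset.mem_filter.2 ⟨hu, rfl⟩)
  have h2 : 0 ≤ ∑ w ∈ W, √(x w) := Finset.sum_nonneg fun _ _ => Real.sqrt_nonneg _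
  have h3 : 0 ≤ (1 - γ) * x (d u) := mul_nonneg (by linarith) (hx _)
  have h4 : γ * (√(x u) / ∑ w ∈ W, √(x w))
      ≤ γ * ((∑ w ∈ W with d w = d u, √(x w)) / ∑ w ∈ W, √(x w)) := by gcongr
  rw [exploreMix]
  linarith

theorem le_obsProb {V : Type} [Fintype V] {E : V → V → Bool} {p : V → ℝ} (hp : ∀ a, 0 ≤ p a)
    {a i : V} (h : E a i) : p a ≤ obsProb E p i := by
  have := Finset.single_le_sum (f := fun a => if E a i then p a else 0) (s := Finset.univ)
    (fun b _ => by split_ifs <;> simp [hp]) (Finset.mem_univ a)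
  simpa [h, obsProb] using this

theorem mul_one_sub_le_obsProb {V : Type} [Fintype V] {E : V → V → Bool} {p x : V → ℝ} {c : ℝ}
    (hp : ∀ a, 0 ≤ p a) (hx : ∑ a, x a = 1) (hpx : ∀ a, c * x a ≤ p a) {v : V}
    (h : ∀ u, u ≠ v → E u v) : c * (1 - x v) ≤ obsProb E p v := by
  classical
  rw [← hx, ← Finset.sum_erase_eq_sub (Finset.mem_univ v), Finset.mul_sum, obsProb]
  calc _ ≤ ∑ a ∈ Finset.univ.erase v, if E a v then p a else 0 := by
        refine Finset.sum_le_sum fun a ha => ?_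
        rw [if_pos (h a (Finset.ne_of_mem_erase ha))]
        exact hpx a
    _ ≤ _ := Finset.sum_le_sum_of_subset_of_nonneg (Finset.erase_subset _ _)
        fun b _ _ => by split_ifs <;> simp [hp]

theorem sum_mul_lossEstimate {V : Type} [Fintype V] {E : V → V → Bool} {p : V → ℝ} (ℓ : V → ℝ)
    {i : V} (h : 0 < obsProb E p i) : ∑ a, p a * lossEstimate E p ℓ a i = ℓ i := by
  have : ∀ a, p a * lossEstimate E p ℓ a i
      = (if E a i then p a else 0) * (ℓ i / obsProb E p i) := fun a => by
    rw [lossEstimate]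
    split_ifs <;> simp
  rw [Finset.sum_congr rfl fun a _ => this a, ← Finset.sum_mul, ← obsProb]
  field_simp

theorem sum_mul_lossEstimate_sq_le {V : Type} [Fintype V] {E : V → V → Bool} {p ℓ : V → ℝ}
    {i : V} (h : 0 < obsProb E p i) (h0 : 0 ≤ ℓ i) (h1 : ℓ i ≤ 1) :
    ∑ a, p a * lossEstimate E p ℓ a i ^ 2 ≤ 1 / obsProb E p i := by
  have : ∀ a, p a * lossEstimate E p ℓ a i ^ 2
      = (if E a i then p a else 0) * (ℓ i / obsProb E p i) ^ 2 := fun a => by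
    rw [lossEstimate]
    split_ifs <;> simp
  rw [Finset.sum_congr rfl fun a _ => this a, ← Finset.sum_mul, ← obsProb]
  have h2 : obsProb E p i * (ℓ i / obsProb E p i) ^ 2 = ℓ i ^ 2 / obsProb E p i := by
    field_simp
  rw [h2]
  gcongr
  exact pow_le_one₀ h0 h1

theorem lossEstimate_nonneg {V : Type} [Fintype V] {E : V → V → Bool} {p ℓ : V → ℝ}
    (hp : ∀ a, 0 ≤ p a) (h0 : ∀ i, 0 ≤ ℓ i) (a i : V) : 0 ≤ lossEstimate E p ℓ a i := by
  have : 0 ≤ obsProb E p i := Finset.sum_nonneg fun b _ => by split_ifs <;> simp [hp]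
  rw [lossEstimate]
  split_ifs
  · exact div_nonneg (h0 i) this
  · exact le_rfl

theorem lossEstimate_le {V : Type} [Fintype V] {E : V → V → Bool} {p ℓ : V → ℝ}
    {i : V} (h : 0 < obsProb E p i) (h1 : ℓ i ≤ 1) (a : V) :
    lossEstimate E p ℓ a i ≤ 1 / obsProb E p i := by
  rw [lossEstimate]
  split_ifs
  · gcongr
  · positivity

theorem sum_sqrt_le_sqrt_card {V : Type} [Fintype V] (W : Finset V) {x : V → ℝ}
    (hx : ∀ i, 0 ≤ x i) (h1 : ∑ i, x i = 1) : ∑ u ∈ W, √(x u) ≤ √(W.card : ℝ) := by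
  refine Real.le_sqrt_of_sq_le ?_
  calc _ ≤ (W.card : ℝ) * ∑ u ∈ W, √(x u) ^ 2 := sq_sum_le_card_mul_sum_sq
    _ = (W.card : ℝ) * ∑ u ∈ W, x u := by
        congr 1
        exact Finset.sum_congr rfl fun u _ => Real.sq_sqrt (hx u)
    _ ≤ (W.card : ℝ) * 1 := by
        gcongr
        rw [← h1]
        exact Finset.sum_le_sum_of_subset_of_nonneg (Finset.subset_univ _) fun i _ _ => hx i
    _ = _ := mul_one _

/-- Variance of a single coordinate of the loss estimate, except for an arm without self-loop that
carries more than half of the mass. -/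
theorem variance_coordinate_le {V : Type} [Fintype V] [DecidableEq V] {E : V → V → Bool}
    {W : Finset V} {d : V → V} (hW : ∀ i ∉ W, StronglyObservableVertex E i)
    (hd : ∀ u ∈ W, E (d u) u) {γ η₁ η₂ : ℝ} (hγ : 0 < γ) (hγ1 : γ ≤ 1 / 2) (hη₁ : 0 < η₁)
    (hη₂ : 0 < η₂) {η x : V → ℝ} (hηW : ∀ i ∈ W, η i = η₁) (hηS : ∀ i ∉ W, η i = η₂)
    (hx : ∀ i, 0 < x i) (hx1 : ∑ i, x i = 1) {i : V}
    (hi : ¬ (i ∉ W ∧ ¬ E i i ∧ 1 / 2 < x i)) :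
    2 * η i * (x i * √(x i)) * (1 / obsProb E (exploreMix W d γ x) i)
      ≤ 2 * η₁ * √(W.card : ℝ) / γ * x i + 8 * η₂ := by
  have hmix := mul_le_exploreMix W d x hγ.le
  have hp : ∀ a, 0 ≤ exploreMix W d γ x a := fun a =>
    (mul_nonneg (by linarith) (hx a).le).trans (hmix a)
  have hr := Real.sqrt_pos.2 (hx i)
  have hxle : x i ≤ 1 := by
    rw [← hx1]
    exact Finset.single_le_sum (fun j _ => (hx j).le) (Finset.mem_univ i)
  have hr1 : √(x i) ≤ 1 := Real.sqrt_le_one.2 hxle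
  have hxi := hx i
  rw [mul_one_div]
  by_cases hiW : i ∈ W
  · have hS : 0 < ∑ u ∈ W, √(x u) := Finset.sum_pos (fun u _ => Real.sqrt_pos.2 (hx u)) ⟨i, hiW⟩
    have hP := (mul_sqrt_div_le_exploreMix d hγ.le (by linarith) (fun j => (hx j).le) hiW).trans
      (le_obsProb hp (hd i hiW))
    have hSW := sum_sqrt_le_sqrt_card W (fun j => (hx j).le) hx1
    rw [hηW i hiW]
    calc _ ≤ 2 * η₁ * (x i * √(x i)) / (γ * (√(x i) / ∑ w ∈ W, √(x w))) := by gcongr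
      _ = 2 * η₁ * (∑ w ∈ W, √(x w)) / γ * x i := by field_simp
      _ ≤ 2 * η₁ * √(W.card : ℝ) / γ * x i := by gcongr
      _ ≤ _ := by linarith
  · rw [hηS i hiW]
    have h0 : 0 ≤ 2 * η₁ * √(W.card : ℝ) / γ * x i := by positivity
    refine le_trans ?_ (le_add_of_nonneg_left h0)
    have hP : x i / 4 ≤ obsProb E (exploreMix W d γ x) i := by
      by_cases hii : E i i
      · have := (hmix i).trans (le_obsProb hp hii)
        nlinarith
      · have hxh : x i ≤ 1 / 2 := by
          by_contra hc
          exact hi ⟨hiW, hii, not_le.1 hc⟩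
        have := mul_one_sub_le_obsProb hp hx1 hmix ((hW i hiW).resolve_left hii)
        nlinarith
    calc _ ≤ 2 * η₂ * (x i * 1) / (x i / 4) := by gcongr
      _ = 8 * η₂ := by field_simp; ring

/-- The stability term of one round: after a shift by the estimate of a heavy arm without
self-loop, if there is one, the estimates are bounded below and have small variance. -/
theorem exists_shift_variance_le {V : Type} [Fintype V] [DecidableEq V] {E : V → V → Bool}
    (hobs : Observable E)
    {W : Finset V} {d : V → V} (hW : ∀ i ∉ W, StronglyObservableVertex E i)
    (hd : ∀ u ∈ W, E (d u) u) (hne : W.Nonempty)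
    {γ η₁ η₂ ε : ℝ} (hγ : 0 < γ) (hγ1 : γ ≤ 1 / 2) (hη₁ : 0 < η₁)
    (hη : η₁ ≤ η₂) (hε : 0 < ε) (hηε : 4 * η₂ ≤ √ε) {η x ℓ : V → ℝ}
    (hηW : ∀ i ∈ W, η i = η₁) (hηS : ∀ i ∉ W, η i = η₂)
    (hx : x ∈ clippedSimplex V ε) (hℓ0 : ∀ i, 0 ≤ ℓ i) (hℓ1 : ∀ i, ℓ i ≤ 1) :
    ∃ c : V → ℝ,
      (∀ a i, -(1 / 2) ≤
        (lossEstimate E (exploreMix W d γ x) ℓ a i - c a) * η i * √(x i)) ∧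
      ∑ a, exploreMix W d γ x a * ∑ i, 2 * η i * (x i * √(x i))
          * (lossEstimate E (exploreMix W d γ x) ℓ a i - c a) ^ 2
        ≤ 2 * η₁ * √(W.card : ℝ) / γ + (8 * Fintype.card V + 4) * η₂ := by
  have hη₂ : 0 < η₂ := hη₁.trans_le hη
  have hη2 : ∀ i, 0 < η i ∧ η i ≤ η₂ := fun i => by
    by_cases hi : i ∈ W
    · rw [hηW i hi]; exact ⟨hη₁, hη⟩
    · rw [hηS i hi]; exact ⟨hη₂, le_rfl⟩
  have hx0 : ∀ i, 0 < x i := fun i => hε.trans_le (hx.1 i)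
  have hmix := mul_le_exploreMix W d x hγ.le
  set p := exploreMix W d γ x with hpdef
  have hp0 : ∀ a, 0 < p a := fun a =>
    (mul_pos (by linarith) (hx0 a)).trans_le (hmix a)
  have hp : ∀ a, 0 ≤ p a := fun a => (hp0 a).le
  have hP : ∀ i, 0 < obsProb E p i := fun i => by
    obtain ⟨u, hu⟩ := hobs i
    exact (hp0 u).trans_le (le_obsProb hp hu)
  have hest := lossEstimate_nonneg (E := E) hp hℓ0
  have hsum : ∀ A : Finset V, (∀ i ∈ A, ¬ (i ∉ W ∧ ¬ E i i ∧ 1 / 2 < x i)) →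
      ∑ i ∈ A, 2 * η i * (x i * √(x i)) * (1 / obsProb E p i)
        ≤ 2 * η₁ * √(W.card : ℝ) / γ + 8 * Fintype.card V * η₂ := by
    intro A hA
    calc _ ≤ ∑ i ∈ A, (2 * η₁ * √(W.card : ℝ) / γ * x i + 8 * η₂) :=
          Finset.sum_le_sum fun i hi =>
            variance_coordinate_le hW hd hγ hγ1 hη₁ hη₂ hηW hηS hx0 hx.2 (hA i hi)
      _ ≤ ∑ i, (2 * η₁ * √(W.card : ℝ) / γ * x i + 8 * η₂) :=
          Finset.sum_le_sum_of_subset_of_nonneg (Finset.subset_univ _) fun i _ _ => by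
            have := hx0 i
            positivity
      _ = _ := by
          rw [Finset.sum_add_distrib, ← Finset.mul_sum, hx.2]
          simp only [Finset.sum_const, Finset.card_univ, nsmul_eq_mul]
          ring
  have hsq : ∀ A : Finset V, ∑ a, p a * ∑ i ∈ A, 2 * η i * (x i * √(x i))
      * lossEstimate E p ℓ a i ^ 2
        ≤ ∑ i ∈ A, 2 * η i * (x i * √(x i)) * (1 / obsProb E p i) := by
    intro A
    simp only [Finset.mul_sum]
    rw [Finset.sum_comm]
    refine Finset.sum_le_sum fun i _ => ?_
    have h1 := sum_mul_lossEstimate_sq_le (hP i) (hℓ0 i) (hℓ1 i)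
    have h2 : 0 ≤ 2 * η i * (x i * √(x i)) := by
      have := (hη2 i).1
      have := hx0 i
      positivity
    calc _ = 2 * η i * (x i * √(x i)) * ∑ a, p a * lossEstimate E p ℓ a i ^ 2 := by
          rw [Finset.mul_sum]
          exact Finset.sum_congr rfl fun a _ => by ring
      _ ≤ _ := mul_le_mul_of_nonneg_left h1 h2
  by_cases hheavy : ∃ v, v ∉ W ∧ ¬ E v v ∧ 1 / 2 < x v
  · obtain ⟨v, hvW, hvv, hxv⟩ := hheavy
    have hsub : ∑ i ∈ Finset.univ.erase v, x i = 1 - x v := by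
      rw [Finset.sum_erase_eq_sub (Finset.mem_univ v), hx.2]
    have hle : ∀ i, i ≠ v → x i ≤ 1 - x v := fun i hi => by
      rw [← hsub]
      exact Finset.single_le_sum (fun j _ => (hx0 j).le)
        (Finset.mem_erase.2 ⟨hi, Finset.mem_univ i⟩)
    obtain ⟨w, hw⟩ := hne
    have hwv : w ≠ v := fun h => hvW (h ▸ hw)
    have hgap : ε ≤ 1 - x v := (hx.1 w).trans (hle w hwv)
    have hgap0 : 0 < 1 - x v := hε.trans_le hgap
    have hPv : (1 - x v) / 2 ≤ obsProb E p v := by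
      have := mul_one_sub_le_obsProb hp hx.2 hmix ((hW v hvW).resolve_left hvv)
      nlinarith
    have hPv' : 1 / obsProb E p v ≤ 2 / (1 - x v) := by
      rw [div_le_div_iff₀ (hP v) hgap0]
      linarith
    refine ⟨fun a => lossEstimate E p ℓ a v, fun a i => ?_, ?_⟩
    · by_cases hiv : i = v
      · subst hiv
        norm_num
      have h1 := (lossEstimate_le (hP v) (hℓ1 v) a).trans hPv'
      have h2 : √(x i) ≤ √(1 - x v) := Real.sqrt_le_sqrt (hle i hiv)
      have h3 : 2 / (1 - x v) * η₂ * √(1 - x v) ≤ 1 / 2 := by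
        have h4 := Real.sqrt_le_sqrt hgap
        have h5 := Real.sqrt_pos.2 hgap0
        have h6 := Real.sq_sqrt hgap0.le
        rw [div_mul_eq_mul_div, div_mul_eq_mul_div, div_le_iff₀ hgap0]
        nlinarith
      have h7 : lossEstimate E p ℓ a v * η i * √(x i) ≤ 2 / (1 - x v) * η₂ * √(1 - x v) := by
        have := (hη2 i).1.le
        have := (hη2 i).2
        have := hest a v
        gcongr
      have h8 : 0 ≤ lossEstimate E p ℓ a i * η i * √(x i) := by
        have := (hη2 i).1.le
        have := hest a i
        positivity
      rw [sub_mul, sub_mul]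
      linarith
    · have hpt : ∀ a, ∑ i, 2 * η i * (x i * √(x i))
            * (lossEstimate E p ℓ a i - lossEstimate E p ℓ a v) ^ 2
          ≤ ∑ i ∈ Finset.univ.erase v, 2 * η i * (x i * √(x i)) * lossEstimate E p ℓ a i ^ 2
            + 2 * η₂ * (1 - x v) * lossEstimate E p ℓ a v ^ 2 := by
        intro a
        rw [← Finset.add_sum_erase _ _ (Finset.mem_univ v), sub_self, ← hsub, Finset.mul_sum,
          Finset.sum_mul, ← Finset.sum_add_distrib]
        simp only [ne_eq, OfNat.ofNat_ne_zero, not_false_eq_true, zero_pow, mul_zero, zero_add]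
        refine Finset.sum_le_sum fun i _ => ?_
        have ha := hest a i
        have hb := hest a v
        have hxi := hx0 i
        have hηi := (hη2 i).1
        have h1 : (lossEstimate E p ℓ a i - lossEstimate E p ℓ a v) ^ 2
            ≤ lossEstimate E p ℓ a i ^ 2 + lossEstimate E p ℓ a v ^ 2 := by
          nlinarith [mul_nonneg ha hb]
        have h2 : 2 * η i * (x i * √(x i)) ≤ 2 * η₂ * (x i * 1) := by
          have := (hη2 i).2
          have : √(x i) ≤ 1 := Real.sqrt_le_one.2 (by
            rw [← hx.2]
            exact Finset.single_le_sum (fun j _ => (hx0 j).le) (Finset.mem_univ i))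
          gcongr
        calc _ ≤ 2 * η i * (x i * √(x i))
              * (lossEstimate E p ℓ a i ^ 2 + lossEstimate E p ℓ a v ^ 2) := by gcongr
          _ = 2 * η i * (x i * √(x i)) * lossEstimate E p ℓ a i ^ 2
              + 2 * η i * (x i * √(x i)) * lossEstimate E p ℓ a v ^ 2 := by ring
          _ ≤ 2 * η i * (x i * √(x i)) * lossEstimate E p ℓ a i ^ 2
              + 2 * η₂ * (x i * 1) * lossEstimate E p ℓ a v ^ 2 := by gcongr
          _ = _ := by ring
      have hnot : ∀ i ∈ Finset.univ.erase v, ¬ (i ∉ W ∧ ¬ E i i ∧ 1 / 2 < x i) := by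
        rintro i hi ⟨-, -, h⟩
        have := hle i (Finset.ne_of_mem_erase hi)
        linarith
      have hshift : ∑ a, p a * (2 * η₂ * (1 - x v) * lossEstimate E p ℓ a v ^ 2) ≤ 4 * η₂ := by
        calc _ = 2 * η₂ * (1 - x v) * ∑ a, p a * lossEstimate E p ℓ a v ^ 2 := by
              rw [Finset.mul_sum]
              exact Finset.sum_congr rfl fun a _ => by ring
          _ ≤ 2 * η₂ * (1 - x v) * (2 / (1 - x v)) := by
              gcongr
              exact (sum_mul_lossEstimate_sq_le (hP v) (hℓ0 v) (hℓ1 v)).trans hPv'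
          _ = 4 * η₂ := by field_simp; ring
      calc _ ≤ ∑ a, p a * (∑ i ∈ Finset.univ.erase v,
              2 * η i * (x i * √(x i)) * lossEstimate E p ℓ a i ^ 2
              + 2 * η₂ * (1 - x v) * lossEstimate E p ℓ a v ^ 2) :=
            Finset.sum_le_sum fun a _ => mul_le_mul_of_nonneg_left (hpt a) (hp a)
        _ ≤ _ := by
            simp only [mul_add]
            rw [Finset.sum_add_distrib]
            have := (hsq _).trans (hsum _ hnot)
            linarith
  · refine ⟨fun _ => 0, fun a i => ?_, ?_⟩
    · have := (hη2 i).1.le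
      have := hest a i
      have : 0 ≤ (lossEstimate E p ℓ a i - 0) * η i * √(x i) := by
        rw [sub_zero]
        positivity
      linarith
    · simp only [sub_zero]
      have := (hsq _).trans (hsum Finset.univ fun i _ h => hheavy ⟨i, h⟩)
      linarith

/-- The cumulative loss estimate after one more (arm, feedback) pair, when `p L` is the sampling
distribution used at cumulative loss estimate `L`. -/
noncomputable def estimateStep {V : Type} [Fintype V] (E : V → V → Bool) (p : (V → ℝ) → V → ℝ)
    (L : V → ℝ) (af : V × (V → Option ℝ)) : V → ℝ :=
  L + lossEstimate E (p L) (fun i => (af.2 i).getD 0) af.1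

/-- The cumulative loss estimate computed from a history. -/
noncomputable def cumEstimate {V : Type} [Fintype V] (E : V → V → Bool) (p : (V → ℝ) → V → ℝ)
    (h : List (V × (V → Option ℝ))) : V → ℝ :=
  h.foldl (estimateStep E p) 0

/-- The policy that samples from `p L` when the cumulative loss estimate is `L`. -/
noncomputable def estimatePolicy {V : Type} [Fintype V] (E : V → V → Bool) (p : (V → ℝ) → V → ℝ)
    (hp0 : ∀ L a, 0 ≤ p L a) (hp1 : ∀ L, ∑ a, p L a = 1) : Policy V := fun h =>
  PMF.ofFintype (fun a => ENNReal.ofReal (p (cumEstimate E p h) a)) (by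
    rw [← ENNReal.ofReal_sum_of_nonneg fun a _ => hp0 _ a, hp1, ENNReal.ofReal_one])

theorem hist_append_singleton {V : Type} (E : V → V → Bool) (ℓ : ℕ → V → ℝ) (l : List V) (a : V) :
    hist E ℓ (l ++ [a]) = hist E ℓ l ++ [(a, feedbackOf E (ℓ l.length) a)] := by
  rw [hist, hist, List.length_append, List.length_singleton, List.range_succ,
    List.zipWith_append (by simp)]
  rfl

theorem cumEstimate_hist_append_singleton {V : Type} [Fintype V] (E : V → V → Bool)
    (p : (V → ℝ) → V → ℝ) (ℓ : ℕ → V → ℝ) (l : List V) (a : V) :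
    cumEstimate E p (hist E ℓ (l ++ [a])) = cumEstimate E p (hist E ℓ l)
      + lossEstimate E (p (cumEstimate E p (hist E ℓ l))) (ℓ l.length) a := by
  rw [hist_append_singleton, cumEstimate, List.foldl_append, ← cumEstimate]
  simp only [List.foldl_cons, List.foldl_nil, estimateStep]
  congr 1
  ext i
  by_cases h : E a i <;> simp [lossEstimate, feedbackOf, h]

theorem exists_policy_regretTo_le {V : Type} [Fintype V] {E : V → V → Bool}
    (hobs : Observable E) {W : Finset V} (hW : ∀ i ∉ W, StronglyObservableVertex E i)
    (hne : W.Nonempty) {γ η₁ η₂ ε : ℝ} (hγ : 0 < γ) (hγ1 : γ ≤ 1 / 2) (hη₁ : 0 < η₁)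
    (hη : η₁ ≤ η₂) (hε : 0 < ε) (hηε : 4 * η₂ ≤ √ε) (hεN : Fintype.card V * ε ≤ 1) :
    ∃ π : Policy V, ∀ ℓ : ℕ → V → ℝ, ValidLoss ℓ → ∀ (T : ℕ) (a : V),
      regretTo π E ℓ T a ≤ 2 * √(W.card : ℝ) / η₁ + 2 * Fintype.card V / η₂
        + T * (γ + 2 * η₁ * √(W.card : ℝ) / γ + (8 * Fintype.card V + 4) * η₂
          + Fintype.card V * ε) := by
  classical
  have hη₂ : 0 < η₂ := hη₁.trans_le hη
  choose d hd using hobs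
  obtain ⟨w, hw⟩ := hne
  have hmem : ∀ a, (fun i => (1 - Fintype.card V * ε) * (if i = a then 1 else 0) + ε)
      ∈ clippedSimplex V ε := by
    refine fun a => ⟨fun i => ?_, ?_⟩
    · have : 0 ≤ (1 - Fintype.card V * ε) * (if i = a then (1 : ℝ) else 0) :=
        mul_nonneg (by linarith) (by split_ifs <;> norm_num)
      linarith
    · rw [Finset.sum_add_distrib, ← Finset.mul_sum]
      simp
  set η : V → ℝ := fun i => if i ∈ W then η₁ else η₂ with hηdef
  have hηW : ∀ i ∈ W, η i = η₁ := fun i hi => if_pos hi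
  have hηS : ∀ i ∉ W, η i = η₂ := fun i hi => if_neg hi
  have hηpos : ∀ i, 0 < η i := fun i => by
    by_cases hi : i ∈ W
    · rwa [hηW i hi]
    · rwa [hηS i hi]
  choose X hXmem hXmin using fun L : V → ℝ =>
    exists_tsallisObjective_minimizer η L ⟨_, hmem w⟩ hε.le
  have hX0 : ∀ L i, 0 < X L i := fun L i => hε.trans_le ((hXmem L).1 i)
  have hS : ∀ L, 0 < ∑ u ∈ W, √(X L u) := fun L =>
    Finset.sum_pos (fun u _ => Real.sqrt_pos.2 (hX0 L u)) ⟨w, hw⟩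
  set p : (V → ℝ) → V → ℝ := fun L => exploreMix W d γ (X L) with hpdef
  have hmix : ∀ L a, (1 - γ) * X L a ≤ p L a := fun L a => mul_le_exploreMix W d (X L) hγ.le a
  have hp0 : ∀ L a, 0 < p L a := fun L a =>
    (mul_pos (by linarith) (hX0 L a)).trans_le (hmix L a)
  have hp1 : ∀ L, ∑ a, p L a = 1 := fun L => exploreMix_sum d γ (hXmem L).2 (hS L)
  refine ⟨estimatePolicy E p (fun L a => (hp0 L a).le) hp1, fun ℓ hℓ T a => ?_⟩
  set u : V → ℝ := fun i => (1 - Fintype.card V * ε) * (if i = a then 1 else 0) + ε with hu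
  set S : List V → V → ℝ := fun l => cumEstimate E p (hist E ℓ l) with hSdef
  set k : ℝ := γ + (2 * η₁ * √(W.card : ℝ) / γ + (8 * Fintype.card V + 4) * η₂) with hk
  have hstep : ∀ l : List V, ∑ b, p (S l) b * ((ℓ l.length b - ∑ i, u i * ℓ l.length i)
      + (∑ i, u i * S (l ++ [b]) i - tsallisObjective η (S (l ++ [b])) (X (S (l ++ [b])))))
      ≤ (∑ i, u i * S l i - tsallisObjective η (S l) (X (S l))) + k := by
    intro l
    set ℓt := ℓ l.length with hℓt
    set q := p (S l) with hq
    set x := X (S l) with hx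
    obtain ⟨c, hc1, hc2⟩ := exists_shift_variance_le (fun v => ⟨d v, hd v⟩) hW (fun v _ => hd v)
      ⟨w, hw⟩ hγ hγ1 hη₁ hη hε hηε hηW hηS (hXmem (S l)) (fun i => (hℓ l.length i).1)
      (fun i => (hℓ l.length i).2)
    have hSb : ∀ b, S (l ++ [b]) = S l + lossEstimate E q ℓt b := fun b =>
      cumEstimate_hist_append_singleton E p ℓ l b
    have hP : ∀ i, 0 < obsProb E q i := fun i =>
      (hp0 _ _).trans_le (le_obsProb (fun b => (hp0 _ b).le) (hd i))
    have hmean : ∀ z : V → ℝ, ∑ b, q b * ∑ i, z i * lossEstimate E q ℓt b i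
        = ∑ i, z i * ℓt i := by
      intro z
      simp only [Finset.mul_sum]
      rw [Finset.sum_comm]
      refine Finset.sum_congr rfl fun i _ => ?_
      rw [← sum_mul_lossEstimate ℓt (hP i), Finset.mul_sum]
      exact Finset.sum_congr rfl fun b _ => by ring
    have hexp : ∑ b, q b * ℓt b ≤ ∑ b, x b * ℓt b + γ := by
      have h1 : ∑ b, (q b - (1 - γ) * x b) * ℓt b ≤ ∑ b, (q b - (1 - γ) * x b) * 1 :=
        Finset.sum_le_sum fun b _ => mul_le_mul_of_nonneg_left (hℓ l.length b).2
          (sub_nonneg.2 (hmix (S l) b))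
      have h2 : ∑ b, (q b - (1 - γ) * x b) * 1 = γ := by
        simp only [mul_one]
        rw [Finset.sum_sub_distrib, ← Finset.mul_sum, hp1, (hXmem (S l)).2]
        ring
      have h3 : ∑ b, (q b - (1 - γ) * x b) * ℓt b
          = ∑ b, q b * ℓt b - (1 - γ) * ∑ b, x b * ℓt b := by
        rw [Finset.mul_sum, ← Finset.sum_sub_distrib]
        exact Finset.sum_congr rfl fun b _ => by ring
      have h4 : 0 ≤ ∑ b, x b * ℓt b :=
        Finset.sum_nonneg fun b _ => mul_nonneg (hX0 _ b).le (hℓ l.length b).1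
      nlinarith
    calc _ ≤ ∑ b, q b * ((ℓt b - ∑ i, u i * ℓt i)
          + (∑ i, u i * S l i - tsallisObjective η (S l) x)
          + ∑ i, u i * lossEstimate E q ℓt b i - ∑ i, x i * lossEstimate E q ℓt b i
          + ∑ i, 2 * η i * (x i * √(x i)) * (lossEstimate E q ℓt b i - c b) ^ 2) := by
          refine Finset.sum_le_sum fun b _ => mul_le_mul_of_nonneg_left ?_ (hp0 _ b).le
          have h := tsallisObjective_step (c b) hε hηpos (hXmem (S l)) (hXmem (S (l ++ [b])))
            (hXmin (S l)) (hc1 b)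
          rw [hSb b] at h ⊢
          simp only [Pi.add_apply, mul_add, Finset.sum_add_distrib]
          linarith
      _ = (∑ b, q b * ℓt b) + (∑ b, q b) * (∑ i, u i * S l i - tsallisObjective η (S l) x
            - ∑ i, u i * ℓt i) + ∑ b, q b * ∑ i, u i * lossEstimate E q ℓt b i
          - ∑ b, q b * ∑ i, x i * lossEstimate E q ℓt b i
          + ∑ b, q b * ∑ i, 2 * η i * (x i * √(x i)) * (lossEstimate E q ℓt b i - c b) ^ 2 := by
          rw [Finset.sum_mul, ← Finset.sum_add_distrib, ← Finset.sum_add_distrib,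
            ← Finset.sum_sub_distrib, ← Finset.sum_add_distrib]
          exact Finset.sum_congr rfl fun b _ => by ring
      _ ≤ _ := by
          rw [hmean, hmean, hp1]
          linarith
  have hmain := sum_prod_take_mul_le (p := fun l => p (S l)) (fun l b => (hp0 _ b).le)
    (fun l => hp1 _) (fun t b => ℓ t b - ∑ i, u i * ℓ t i)
    (fun l => ∑ i, u i * S l i - tsallisObjective η (S l) (X (S l))) k hstep T
  have hone := sum_prod_take_eq_one (p := fun l => p (S l)) (fun l => hp1 _) T
  have hinit : (∑ i, u i * S [] i - tsallisObjective η (S []) (X (S [])))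
      ≤ 2 * √(W.card : ℝ) / η₁ + 2 * Fintype.card V / η₂ := by
    have hS0 : S [] = 0 := rfl
    rw [hS0]
    simp only [tsallisObjective, Pi.zero_apply, mul_zero, Finset.sum_const_zero, zero_mul,
      zero_sub, Finset.sum_neg_distrib, neg_neg]
    rw [← Finset.sum_add_sum_compl W]
    have h1 : ∑ i ∈ W, 2 * √(X 0 i) / η i ≤ 2 * √(W.card : ℝ) / η₁ := by
      rw [Finset.sum_congr rfl fun i hi => by rw [hηW i hi], ← Finset.sum_div, ← Finset.mul_sum]
      have := sum_sqrt_le_sqrt_card W (fun i => (hX0 0 i).le) (hXmem 0).2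
      gcongr
    have h2 : ∑ i ∈ Wᶜ, 2 * √(X 0 i) / η i ≤ 2 * Fintype.card V / η₂ := by
      calc _ ≤ ∑ i ∈ Wᶜ, 2 * 1 / η₂ := by
            refine Finset.sum_le_sum fun i hi => ?_
            rw [hηS i (Finset.mem_compl.1 hi)]
            have : √(X 0 i) ≤ 1 := Real.sqrt_le_one.2 (by
              rw [← (hXmem 0).2]
              exact Finset.single_le_sum (fun j _ => (hX0 0 j).le) (Finset.mem_univ i))
            gcongr
        _ = (Wᶜ.card : ℝ) * (2 * 1 / η₂) := by rw [Finset.sum_const, nsmul_eq_mul]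
        _ ≤ (Fintype.card V : ℝ) * (2 * 1 / η₂) := by
            gcongr
            exact Finset.card_le_univ _
        _ = _ := by ring
    linarith
  have hpoint : ∀ as : Fin T → V,
      (∑ t : Fin T, ℓ t (as t)) - (∑ t : Fin T, ℓ t a + T * (Fintype.card V * ε))
        ≤ ∑ t : Fin T, (ℓ t (as t) - ∑ i, u i * ℓ t i)
          + (∑ i, u i * S (List.ofFn as) i
            - tsallisObjective η (S (List.ofFn as)) (X (S (List.ofFn as)))) := by
    intro as
    have h1 : tsallisObjective η (S (List.ofFn as)) (X (S (List.ofFn as)))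
        ≤ ∑ i, u i * S (List.ofFn as) i := by
      refine (hXmin _ u (hmem a)).trans (Finset.sum_le_sum fun i _ => ?_)
      have : 0 ≤ 2 * √(u i) / η i := by
        have := hηpos i
        positivity
      rw [mul_comm]
      linarith
    have h2 : ∀ t : Fin T, ∑ i, u i * ℓ t i ≤ ℓ t a + Fintype.card V * ε := by
      intro t
      calc _ = (1 - Fintype.card V * ε) * ℓ t a + ε * ∑ i, ℓ t i := by
            simp only [hu, add_mul, Finset.sum_add_distrib, Finset.mul_sum]
            simp
        _ ≤ 1 * ℓ t a + ε * ∑ _i : V, 1 := by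
            have := (hℓ t a).1
            have : (1 - Fintype.card V * ε) ≤ 1 := by
              have : 0 ≤ Fintype.card V * ε := by positivity
              linarith
            gcongr with i
            exact (hℓ t i).2
        _ = _ := by
            simp
            ring
    have h3 := Finset.sum_le_sum fun t (_ : t ∈ (Finset.univ : Finset (Fin T))) => h2 t
    rw [Finset.sum_add_distrib, Finset.sum_const, Finset.card_univ, Fintype.card_fin,
      nsmul_eq_mul] at h3
    rw [Finset.sum_sub_distrib]
    linarith
  have hprob : ∀ as : Fin T → V,
      seqProb (estimatePolicy E p (fun L a => (hp0 L a).le) hp1) E ℓ T as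
        = ∏ t : Fin T, p (S ((List.ofFn as).take t)) (as t) := fun as =>
    Finset.prod_congr rfl fun t _ => ENNReal.toReal_ofReal (hp0 _ _).le
  have hlow := Finset.sum_le_sum fun as (_ : as ∈ (Finset.univ : Finset (Fin T → V))) =>
    mul_le_mul_of_nonneg_left (hpoint as)
      (Finset.prod_nonneg fun t (_ : t ∈ (Finset.univ : Finset (Fin T))) =>
        (hp0 (S ((List.ofFn as).take t)) (as t)).le)
  simp only [mul_sub _ (∑ t : Fin T, ℓ t (_ : V))] at hlow
  rw [Finset.sum_sub_distrib, ← Finset.sum_mul, hone] at hlow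
  rw [regretTo, expectedLoss]
  simp only [hprob]
  linarith

/-- If `G` is a weakly observable graph on `N` vertices with at most
`C ≥ 1` vertices that are not strongly observable, then for sufficiently large `T`
there is a policy whose regret is at most `9 · (4C)^{1/3} · T^{2/3}` against every
loss sequence and every arm. -/
theorem corrupted_strongly_observable_regret
    {V : Type} [Fintype V] (E : V → V → Bool) (N C : ℕ)
    (hN : Fintype.card V = N) (hC : 1 ≤ C)
    (hweak : WeaklyObservable E)
    (hcorrupt : {v : V | ¬ StronglyObservableVertex E v}.ncard ≤ C) :
    ∃ T₀ : ℕ, ∀ T : ℕ, T₀ ≤ T → ∃ π : Policy V,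
      ∀ ℓ : ℕ → V → ℝ, ValidLoss ℓ → ∀ a : V,
        regretTo π E ℓ T a ≤
          9 * ((4 * (C : ℝ)) ^ ((1 : ℝ) / 3)) * (T : ℝ) ^ ((2 : ℝ) / 3) := by
  classical
  set W : Finset V := Finset.univ.filter fun v => ¬ StronglyObservableVertex E v with hWdef
  have hW : ∀ i ∉ W, StronglyObservableVertex E i := fun i hi => by simpa [hWdef] using hi
  have hne : W.Nonempty := by
    obtain ⟨v, hv⟩ := not_forall.1 hweak.2
    exact ⟨v, by simpa [hWdef] using hv⟩
  have hWC : W.card ≤ C := by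
    rwa [Set.ncard_eq_toFinset_card', Set.toFinset_ofPred] at hcorrupt
  have hN1 : (1 : ℝ) ≤ N := by
    rw [← hN]
    exact_mod_cast Fintype.card_pos_iff.2 ⟨hne.choose⟩
  have hroot : ∀ z : ℝ, 0 ≤ z → (z ^ ((1 : ℝ) / 6)) ^ 6 = z := fun z hz => by
    rw [← Real.rpow_natCast, ← Real.rpow_mul hz]
    norm_num
  refine ⟨(15 * N) ^ 6 + 64 * C, fun T hT => ?_⟩
  have hC1 : (1 : ℝ) ≤ C := by exact_mod_cast hC
  have hTR : (15 * (N : ℝ)) ^ 6 + 64 * C ≤ T := by exact_mod_cast hT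
  set b : ℝ := (C : ℝ) ^ ((1 : ℝ) / 6) with hb
  set t : ℝ := (T : ℝ) ^ ((1 : ℝ) / 6) with ht
  have hb6 : b ^ 6 = C := hroot _ (by positivity)
  have ht6 : t ^ 6 = T := hroot _ (by positivity)
  have ht0 : 0 ≤ t := by positivity
  have hb0 : 0 ≤ b := by positivity
  have hb1 : 1 ≤ b := Real.one_le_rpow hC1 (by norm_num)
  have htN : 15 * (N : ℝ) ≤ t := by
    refine le_of_pow_le_pow_left₀ (by norm_num : (6 : ℕ) ≠ 0) ht0 ?_
    rw [ht6]
    linarith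
  have htb : 2 * b ≤ t := by
    refine le_of_pow_le_pow_left₀ (by norm_num : (6 : ℕ) ≠ 0) ht0 ?_
    rw [ht6, mul_pow, hb6]
    have : 0 ≤ (15 * (N : ℝ)) ^ 6 := by positivity
    linarith
  have ht15 : 15 ≤ t := by linarith
  have htpos : 0 < t := by linarith
  have ht3 : 16 * t ≤ t ^ 3 := by
    have : 16 ≤ t ^ 2 := by nlinarith
    nlinarith
  have hCroot : √(W.card : ℝ) ≤ b ^ 3 := by
    refine Real.sqrt_le_iff.2 ⟨by positivity, ?_⟩
    rw [← pow_mul, hb6]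
    exact_mod_cast hWC
  obtain ⟨π, hπ⟩ := exists_policy_regretTo_le hweak.1 hW hne (γ := b ^ 2 / t ^ 2)
    (η₁ := b / t ^ 4) (η₂ := 1 / t ^ 3) (ε := 1 / t ^ 3) (by positivity)
    (by
      rw [div_le_iff₀ (by positivity)]
      nlinarith)
    (by positivity)
    (by
      rw [div_le_div_iff₀ (by positivity) (by positivity)]
      have : 0 ≤ t ^ 3 := by positivity
      nlinarith)
    (by positivity)
    (by
      refine Real.le_sqrt_of_sq_le ?_
      rw [mul_one_div, div_pow, div_le_div_iff₀ (by positivity) (by positivity)]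
      have : 0 ≤ t ^ 3 := by positivity
      nlinarith)
    (by
      rw [hN, mul_one_div, div_le_one (by positivity)]
      linarith)
  refine ⟨π, fun ℓ hℓ a => (hπ ℓ hℓ T a).trans ?_⟩
  rw [hN, ← ht6]
  have hCb : b ^ 2 ≤ (4 * (C : ℝ)) ^ ((1 : ℝ) / 3) := by
    have h : b ^ 2 = (C : ℝ) ^ ((1 : ℝ) / 3) := by
      rw [hb, ← Real.rpow_natCast, ← Real.rpow_mul (by positivity)]
      norm_num
    rw [h]
    exact Real.rpow_le_rpow (by positivity) (by linarith) (by norm_num)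
  have hT4 : (t ^ 6) ^ ((2 : ℝ) / 3) = t ^ 4 := by
    rw [← Real.rpow_natCast, ← Real.rpow_natCast, ← Real.rpow_mul ht0]
    norm_num
  rw [hT4]
  calc _ ≤ 2 * b ^ 3 / (b / t ^ 4) + 2 * N / (1 / t ^ 3)
        + t ^ 6 * (b ^ 2 / t ^ 2 + 2 * (b / t ^ 4) * b ^ 3 / (b ^ 2 / t ^ 2)
          + (8 * N + 4) * (1 / t ^ 3) + N * (1 / t ^ 3)) := by gcongr
    _ = 5 * b ^ 2 * t ^ 4 + (11 * N + 4) * t ^ 3 := by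
        field_simp
        ring
    _ ≤ 5 * b ^ 2 * t ^ 4 + t * t ^ 3 := by
        gcongr
        linarith
    _ ≤ 9 * b ^ 2 * t ^ 4 := by
        have : 1 ≤ b ^ 2 := one_le_pow₀ hb1
        have : 0 ≤ t ^ 4 := by positivity
        nlinarith
    _ ≤ _ := by gcongr
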